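/- arXiv:1705.05184 — 2 statements merged into one kernel-verified Lean document; each statement's English description precedes it below -/
import Mathlib

section
/- Let m ≥ 1 be a real number and θ ∈ (1/m, 1). Then the equation h = m · f_θ(h) has exactly three solutions: 0, h₀ and −h₀, for a unique h₀ > 0. -/
/-- Inverse hyperbolic tangent. -/
noncomputable def artanh (x : ℝ) : ℝ := (1 / 2) * Real.log ((1 + x) / (1 - x))

/-- The function `f_θ(h) = arctanh(θ · tanh h)`. -/
noncomputable def isingF (θ h : ℝ) : ℝ := artanh (θ * Real.tanh h)

theorem isingF_eq (θ h : ℝ) :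
    isingF θ h = (1 / 2) * Real.log ((Real.cosh h + θ * Real.sinh h) / (Real.cosh h - θ * Real.sinh h)) := by
  have hc := Real.cosh_pos h
  unfold isingF artanh
  rw [Real.tanh_eq_sinh_div_cosh]
  congr 2
  rw [show 1 + θ * (Real.sinh h / Real.cosh h) = (Real.cosh h + θ * Real.sinh h) / Real.cosh h by
      field_simp,
    show 1 - θ * (Real.sinh h / Real.cosh h) = (Real.cosh h - θ * Real.sinh h) / Real.cosh h by
      field_simp, div_div_div_cancel_right₀ hc.ne']

theorem cosh_add_pos (θ h : ℝ) (h0 : -1 < θ) (h1 : θ < 1) :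
    0 < Real.cosh h + θ * Real.sinh h := by
  rw [Real.cosh_eq, Real.sinh_eq]
  have := Real.exp_pos h
  have := Real.exp_pos (-h)
  nlinarith

theorem cosh_sub_pos (θ h : ℝ) (h0 : -1 < θ) (h1 : θ < 1) :
    0 < Real.cosh h - θ * Real.sinh h := by
  have := cosh_add_pos (-θ) h (by linarith) (by linarith)
  linarith

theorem isingF_neg (θ h : ℝ) : isingF θ (-h) = - isingF θ h := by
  rw [isingF_eq, isingF_eq, Real.cosh_neg, Real.sinh_neg,
    ← inv_div (Real.cosh h - θ * Real.sinh h), Real.log_inv]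
  simp only [mul_neg, sub_neg_eq_add, ← sub_eq_add_neg, neg_neg]

theorem isingF_hasDerivAt (θ h : ℝ) (h0 : 0 < θ) (h1 : θ < 1) :
    HasDerivAt (isingF θ) (θ / (1 + (1 - θ ^ 2) * Real.sinh h ^ 2)) h := by
  have hp := cosh_add_pos θ h (by linarith) h1
  have hn := cosh_sub_pos θ h (by linarith) h1
  rw [show isingF θ = _ from funext (isingF_eq θ)]
  have e1 := (Real.hasDerivAt_cosh h).add ((Real.hasDerivAt_sinh h).const_mul θ)
  have e2 := (Real.hasDerivAt_cosh h).sub ((Real.hasDerivAt_sinh h).const_mul θ)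
  have e3 := ((e1.div e2 hn.ne').log (div_pos hp hn).ne').const_mul (1 / 2)
  refine e3.congr_deriv ?_
  have hq : 0 < 1 + (1 - θ ^ 2) * Real.sinh h ^ 2 := by
    have : 0 < 1 - θ ^ 2 := by nlinarith
    positivity
  have hcs := Real.cosh_sq h
  have hprod : 1 + (1 - θ ^ 2) * Real.sinh h ^ 2 =
      (Real.cosh h + θ * Real.sinh h) * (Real.cosh h - θ * Real.sinh h) := by
    linear_combination -hcs
  rw [hprod]
  simp only [Pi.add_apply, Pi.sub_apply, Pi.div_apply]
  have hnum : (Real.sinh h + θ * Real.cosh h) * (Real.cosh h - θ * Real.sinh h) -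
      (Real.cosh h + θ * Real.sinh h) * (Real.sinh h - θ * Real.cosh h) = 2 * θ := by
    linear_combination (2 * θ) * hcs
  rw [hnum]
  generalize Real.cosh h + θ * Real.sinh h = P at hp ⊢
  generalize Real.cosh h - θ * Real.sinh h = N at hn ⊢
  field_simp

theorem isingF_le (θ h : ℝ) (h0 : 0 < θ) (h1 : θ < 1) :
    isingF θ h ≤ (1 / 2) * Real.log ((1 + θ) / (1 - θ)) := by
  have hp := cosh_add_pos θ h (by linarith) h1
  have hn := cosh_sub_pos θ h (by linarith) h1
  rw [isingF_eq]
  have : 0 < 1 - θ := by linarith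
  gcongr ?_ * ?_
  apply Real.log_le_log (by positivity)
  rw [div_le_div_iff₀ hn this]
  nlinarith [Real.sinh_lt_cosh h]

theorem isingF_fixed_point_three_solutions (m θ : ℝ) (hm : 1 ≤ m)
    (hθ : θ ∈ Set.Ioo (1 / m) 1) :
    ∃! h₀ : ℝ, 0 < h₀ ∧
      ∀ h : ℝ, h = m * isingF θ h ↔ (h = 0 ∨ h = h₀ ∨ h = -h₀) := by
  obtain ⟨hθm, h1⟩ := hθ
  have hm0 : 0 < m := by linarith
  have h0 : 0 < θ := lt_trans (by positivity) hθm
  have hmθ : 1 < θ * m := (div_lt_iff₀ hm0).1 hθm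
  have hθ2 : 0 < 1 - θ ^ 2 := by nlinarith
  set g : ℝ → ℝ := fun h => m * isingF θ h - h with hg
  have hd : ∀ h, HasDerivAt g (m * (θ / (1 + (1 - θ ^ 2) * Real.sinh h ^ 2)) - 1) h := fun h =>
    ((isingF_hasDerivAt θ h h0 h1).const_mul m).sub (hasDerivAt_id h)
  have hcont : Continuous g := continuous_iff_continuousAt.2 fun h => (hd h).continuousAt
  have hg0 : g 0 = 0 := by simp [hg, isingF, artanh]
  have hconc : StrictConcaveOn ℝ (Set.Ici 0) g := by
    apply StrictAntiOn.strictConcaveOn_of_deriv (convex_Ici 0) hcont.continuousOn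
    rw [interior_Ici]
    intro a ha b hb hab
    rw [(hd a).deriv, (hd b).deriv]
    have hsa : 0 < Real.sinh a := Real.sinh_pos_iff.2 ha
    have hs : Real.sinh a < Real.sinh b := Real.sinh_lt_sinh.2 hab
    have : Real.sinh a ^ 2 < Real.sinh b ^ 2 := by gcongr
    gcongr
  -- uniqueness of positive zeros
  have huniq : ∀ a b, 0 < a → a < b → g a = 0 → g b = 0 → False := by
    intro a b ha hab ga gb
    have hb : 0 < b := ha.trans hab
    have := hconc.2 (show (0 : ℝ) ∈ Set.Ici 0 by simp) (show b ∈ Set.Ici 0 from hb.le) hb.ne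
      (show 0 < 1 - a / b by rw [sub_pos, div_lt_one hb]; exact hab)
      (show 0 < a / b by positivity) (by ring)
    simp only [smul_eq_mul, hg0, gb, mul_zero, zero_add, div_mul_cancel₀ _ hb.ne', ga] at this
    exact lt_irrefl _ this
  -- a small positive point with g > 0
  obtain ⟨ε, hε, gε⟩ : ∃ ε, 0 < ε ∧ 0 < g ε := by
    have ht := (hd 0).tendsto_slope_zero_right
    have hpos : 0 < m * (θ / (1 + (1 - θ ^ 2) * Real.sinh 0 ^ 2)) - 1 := by
      simp; linarith
    have hev := (ht.eventually_const_lt hpos).and self_mem_nhdsWithin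
    obtain ⟨ε, h2, h3⟩ := hev.exists
    have h3 : 0 < ε := h3
    refine ⟨ε, h3, ?_⟩
    simp only [zero_add, hg0, sub_zero, smul_eq_mul] at h2
    exact (pos_iff_pos_of_mul_pos h2).1 (by positivity)
  obtain ⟨H, hH, gH⟩ : ∃ H, ε ≤ H ∧ g H ≤ 0 := by
    refine ⟨max ε (m * ((1 / 2) * Real.log ((1 + θ) / (1 - θ)))), le_max_left _ _, ?_⟩
    have h2 := le_max_right ε (m * ((1 / 2) * Real.log ((1 + θ) / (1 - θ))))
    have h3 := mul_le_mul_of_nonneg_left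
      (isingF_le θ (max ε (m * ((1 / 2) * Real.log ((1 + θ) / (1 - θ))))) h0 h1) hm0.le
    simp only [hg]
    linarith
  obtain ⟨z, hz, gz⟩ := intermediate_value_Icc' hH hcont.continuousOn ⟨gH, gε.le⟩
  have hz0 : 0 < z := hε.trans_le hz.1
  have hu : ∀ a, 0 < a → g a = 0 → a = z := by
    intro a ha ga
    rcases lt_trichotomy a z with h | h | h
    · exact (huniq a z ha h ga gz).elim
    · exact h
    · exact (huniq z a hz0 h gz ga).elim
  have hodd : ∀ a, g (-a) = - g a := by
    intro a
    simp only [hg, isingF_neg]; ring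
  have hiff : ∀ h, h = m * isingF θ h ↔ g h = 0 := by
    intro h
    simp only [hg, sub_eq_zero]; exact eq_comm
  refine ⟨z, ⟨hz0, fun h => ?_⟩, ?_⟩
  · rw [hiff]
    constructor
    · intro gh
      rcases lt_trichotomy h 0 with h' | h' | h'
      · right; right
        rw [← hu (-h) (by linarith) (by rw [hodd, gh, neg_zero]), neg_neg]
      · exact Or.inl h'
      · exact Or.inr (Or.inl (hu h h' gh))
    · rintro (rfl | rfl | rfl)
      · exact hg0
      · exact gz
      · rw [hodd, gz, neg_zero]
  · rintro y ⟨hy, hy2⟩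
    exact hu y hy ((hiff y).1 ((hy2 y).2 (Or.inr (Or.inl rfl))))
end

section
/- Let θ ∈ (−1,1), let k ≥ 1 and 1 ≤ m ≤ k be integers, and define the map W : ℝ⁴ → ℝ⁴ by W(h₁,h₂,h₃,h₄) = (m·f_θ(h₃) + (k−m)·f_θ(h₁), (m−1)·f_θ(h₃) + (k+1−m)·f_θ(h₁), (m−1)·f_θ(h₂) + (k+1−m)·f_θ(h₄), m·f_θ(h₂) + (k−m)·f_θ(h₄)). Then W maps each of the following sets into itself: I₁ = {h ∈ ℝ⁴ : h₁ = h₂ = h₃ = h₄}, I₂ = {h ∈ ℝ⁴ : h₁ = h₄ and h₂ = h₃}, and I₃ = {h ∈ ℝ⁴ : h₁ = −h₄ and h₂ = −h₃}. -/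
theorem isingF_odd (θ h : ℝ) : isingF θ (-h) = -isingF θ h := by
  unfold isingF artanh
  rw [Real.tanh_neg, ← mul_neg, ← Real.log_inv, inv_div]
  congr 3 <;> ring

/-- The map `W` arising from `H_A`-weakly periodic boundary conditions leaves the sets
`I₁ = {h₁ = h₂ = h₃ = h₄}`, `I₂ = {h₁ = h₄, h₂ = h₃}` and `I₃ = {h₁ = −h₄, h₂ = −h₃}`
invariant. -/
theorem W_invariant_sets (θ : ℝ) (hθ : θ ∈ Set.Ioo (-1 : ℝ) 1)
    (k m : ℕ) (hk : 1 ≤ k) (hm : 1 ≤ m) (hmk : m ≤ k)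
    (W : (ℝ × ℝ × ℝ × ℝ) → (ℝ × ℝ × ℝ × ℝ))
    (hW : ∀ h₁ h₂ h₃ h₄ : ℝ, W (h₁, h₂, h₃, h₄) =
      ((m : ℝ) * isingF θ h₃ + ((k : ℝ) - (m : ℝ)) * isingF θ h₁,
       ((m : ℝ) - 1) * isingF θ h₃ + ((k : ℝ) + 1 - (m : ℝ)) * isingF θ h₁,
       ((m : ℝ) - 1) * isingF θ h₂ + ((k : ℝ) + 1 - (m : ℝ)) * isingF θ h₄,
       (m : ℝ) * isingF θ h₂ + ((k : ℝ) - (m : ℝ)) * isingF θ h₄)) :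
    (Set.MapsTo W {h : ℝ × ℝ × ℝ × ℝ | h.1 = h.2.1 ∧ h.2.1 = h.2.2.1 ∧ h.2.2.1 = h.2.2.2}
      {h : ℝ × ℝ × ℝ × ℝ | h.1 = h.2.1 ∧ h.2.1 = h.2.2.1 ∧ h.2.2.1 = h.2.2.2}) ∧
    (Set.MapsTo W {h : ℝ × ℝ × ℝ × ℝ | h.1 = h.2.2.2 ∧ h.2.1 = h.2.2.1}
      {h : ℝ × ℝ × ℝ × ℝ | h.1 = h.2.2.2 ∧ h.2.1 = h.2.2.1}) ∧
    (Set.MapsTo W {h : ℝ × ℝ × ℝ × ℝ | h.1 = -h.2.2.2 ∧ h.2.1 = -h.2.2.1}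
      {h : ℝ × ℝ × ℝ × ℝ | h.1 = -h.2.2.2 ∧ h.2.1 = -h.2.2.1}) := by
  refine ⟨?_, ?_, ?_⟩
  · rintro ⟨a, b, c, d⟩ ⟨h1, h2, h3⟩
    dsimp only at h1 h2 h3
    subst h1 h2 h3
    simp only [hW, Set.mem_ofPred_eq]
    refine ⟨?_, ?_, ?_⟩ <;> first | trivial | ring
  · rintro ⟨a, b, c, d⟩ ⟨h1, h2⟩
    dsimp only at h1 h2
    subst h1 h2
    simp only [hW, Set.mem_ofPred_eq]
    exact ⟨trivial, trivial⟩
  · rintro ⟨a, b, c, d⟩ ⟨h1, h2⟩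
    dsimp only at h1 h2
    subst h1 h2
    simp only [hW, Set.mem_ofPred_eq, isingF_odd]
    refine ⟨?_, ?_⟩ <;> ring
end
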